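/- arXiv:1904.09782 — 3 statements merged into one kernel-verified Lean document; each statement's English description precedes it below -/
import Mathlib

section
/- For any random number generation algorithm φ that exactly generates Y^n from the coin process X (i.e., satisfies the validity condition), any integer m ≥ 0, and any real numbers τ, λ ≥ 0, the overflow probability of the stopping time T satisfies Pr(T > m) ≥ P_{Y^n}(T_n^c(τ)) − P_{X^m}(S_m(λ)) − 2^{−τ+λ}, and equivalently Pr(T > m) ≥ P_{X^m}(S_m^c(λ)) − P_{Y^n}(T_n(τ)) − 2^{−τ+λ}. -/
open MeasureTheory Filter
open scoped ENNReal Classical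

noncomputable section

namespace RNG

variable {𝒳 𝒴 : Type*}

/-- The length-`m` prefix of an infinite sequence, as a tuple. -/
def pre (ω : ℕ → 𝒳) (m : ℕ) : Fin m → 𝒳 := fun i => ω i

/-- The length-`m` prefix of an infinite sequence, as a list. -/
def preL (ω : ℕ → 𝒳) (m : ℕ) : List 𝒳 := (List.range m).map ω

/-- `P_{X^m}(x^m)` : the probability of the cylinder set of a finite string `x^m`,
for a process with law `μ`. -/
def cylP [MeasurableSpace 𝒳] (μ : Measure (ℕ → 𝒳)) {m : ℕ} (x : Fin m → 𝒳) : ℝ :=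
  (μ {ω | ∀ i : Fin m, ω i = x i}).toReal

/-- Validity (exact generation) of an algorithm `φ` (given as a full-tree function on finite
coin strings, `none` playing the role of `⊥`): for every target value `y`, the probability
that the algorithm terminates with output `y` equals `PY y`. -/
def Valid {B : Type*} [MeasurableSpace 𝒳] (μ : Measure (ℕ → 𝒳)) (PY : B → ℝ)
    (φ : List 𝒳 → Option B) : Prop :=
  ∀ y : B,
    (μ {ω | ∃ i : ℕ, φ (preL ω i) = some y ∧ ∀ j < i, φ (preL ω j) = none}).toReal = PY y

/-- Strict lexicographic order on strings. -/
def lexLt [LT 𝒳] {m : ℕ} (x' x : Fin m → 𝒳) : Prop :=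
  ∃ i : Fin m, (∀ j : Fin m, j < i → x' j = x j) ∧ x' i < x i

/-- The subinterval of `[0,1)` assigned to the string `x` by the interval algorithm:
strings are arranged in lexicographic order, `x` receiving an interval of length `P x`. -/
def itv [LT 𝒳] [Fintype 𝒳] {m : ℕ} (P : (Fin m → 𝒳) → ℝ) (x : Fin m → 𝒳) : Set ℝ :=
  Set.Ico (∑ x' ∈ Finset.univ.filter (fun x' => lexLt x' x), P x')
    ((∑ x' ∈ Finset.univ.filter (fun x' => lexLt x' x), P x') + P x)

/-- The interval algorithm generating `Y^n` (target law `ν`) from the coin process `μ`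
has stopped after at most `m` coin symbols on the sample `ω`, i.e. the coin interval
`I_{x^m}` is contained in some target interval `J_{y^n}`. -/
def IntStopped [LinearOrder 𝒳] [Fintype 𝒳] [LinearOrder 𝒴] [Fintype 𝒴]
    [MeasurableSpace 𝒳] [MeasurableSpace 𝒴]
    (μ : Measure (ℕ → 𝒳)) (ν : Measure (ℕ → 𝒴)) (n m : ℕ) (ω : ℕ → 𝒳) : Prop :=
  ∃ y : Fin n → 𝒴, itv (fun x : Fin m → 𝒳 => cylP μ x) (pre ω m)
      ⊆ itv (fun y' : Fin n → 𝒴 => cylP ν y') y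

/-- A rate `R` is achievable by the interval algorithm:
`Pr(T_n > nR) → 0` (the stopping time `T_n` is `ℕ`-valued, so `T_n > nR ↔ T_n > ⌊nR⌋`). -/
def IntAchievable [LinearOrder 𝒳] [Fintype 𝒳] [LinearOrder 𝒴] [Fintype 𝒴]
    [MeasurableSpace 𝒳] [MeasurableSpace 𝒴]
    (μ : Measure (ℕ → 𝒳)) (ν : Measure (ℕ → 𝒴)) (R : ℝ) : Prop :=
  0 ≤ R ∧ Tendsto (fun n : ℕ =>
      (μ {ω | ¬ IntStopped μ ν n ⌊(n : ℝ) * R⌋₊ ω}).toReal) atTop (nhds 0)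

/-- `R⋆_int(X,Y)` : the infimum rate achievable by the interval algorithm. -/
def Rint [LinearOrder 𝒳] [Fintype 𝒳] [LinearOrder 𝒴] [Fintype 𝒴]
    [MeasurableSpace 𝒳] [MeasurableSpace 𝒴]
    (μ : Measure (ℕ → 𝒳)) (ν : Measure (ℕ → 𝒴)) : ℝ :=
  sInf {R : ℝ | IntAchievable μ ν R}

/-- A rate `R` is achievable by some sequence of valid algorithms: for each `n` there is a
valid algorithm `φ n` generating `Y^n` and `Pr(T_n > nR) → 0`. -/
def Achievable [MeasurableSpace 𝒳] [MeasurableSpace 𝒴]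
    (μ : Measure (ℕ → 𝒳)) (ν : Measure (ℕ → 𝒴)) (R : ℝ) : Prop :=
  0 ≤ R ∧ ∃ φ : (n : ℕ) → List 𝒳 → Option (Fin n → 𝒴),
    (∀ n : ℕ, Valid μ (fun y : Fin n → 𝒴 => cylP ν y) (φ n)) ∧
    Tendsto (fun n : ℕ =>
      (μ {ω | ∀ i ≤ ⌊(n : ℝ) * R⌋₊, φ n (preL ω i) = none}).toReal) atTop (nhds 0)

/-- `R⋆(X,Y)` : the infimum rate achievable over all valid algorithms. -/
def Rstar [MeasurableSpace 𝒳] [MeasurableSpace 𝒴]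
    (μ : Measure (ℕ → 𝒳)) (ν : Measure (ℕ → 𝒴)) : ℝ :=
  sInf {R : ℝ | Achievable μ ν R}

/-- The expected stopping time `E[T_n]` of the interval algorithm, via `E[T] = ∑_m Pr(T>m)`. -/
def intAvgT [LinearOrder 𝒳] [Fintype 𝒳] [LinearOrder 𝒴] [Fintype 𝒴]
    [MeasurableSpace 𝒳] [MeasurableSpace 𝒴]
    (μ : Measure (ℕ → 𝒳)) (ν : Measure (ℕ → 𝒴)) (n : ℕ) : ℝ≥0∞ :=
  ∑' m : ℕ, μ {ω | ¬ IntStopped μ ν n m ω}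

/-- A rate `L` is average achievable by the interval algorithm: `limsup E[T_n]/n ≤ L`. -/
def IntAvgAchievable [LinearOrder 𝒳] [Fintype 𝒳] [LinearOrder 𝒴] [Fintype 𝒴]
    [MeasurableSpace 𝒳] [MeasurableSpace 𝒴]
    (μ : Measure (ℕ → 𝒳)) (ν : Measure (ℕ → 𝒴)) (L : ℝ≥0∞) : Prop :=
  limsup (fun n : ℕ => intAvgT μ ν n / (n : ℝ≥0∞)) atTop ≤ L

/-- `L⋆_int(X,Y)` : the infimum average achievable rate of the interval algorithm. -/
def Lint [LinearOrder 𝒳] [Fintype 𝒳] [LinearOrder 𝒴] [Fintype 𝒴]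
    [MeasurableSpace 𝒳] [MeasurableSpace 𝒴]
    (μ : Measure (ℕ → 𝒳)) (ν : Measure (ℕ → 𝒴)) : ℝ≥0∞ :=
  sInf {L : ℝ≥0∞ | IntAvgAchievable μ ν L}

/-- A rate `L` is average achievable by some sequence of valid algorithms. -/
def AvgAchievable [MeasurableSpace 𝒳] [MeasurableSpace 𝒴]
    (μ : Measure (ℕ → 𝒳)) (ν : Measure (ℕ → 𝒴)) (L : ℝ≥0∞) : Prop :=
  ∃ φ : (n : ℕ) → List 𝒳 → Option (Fin n → 𝒴),
    (∀ n : ℕ, Valid μ (fun y : Fin n → 𝒴 => cylP ν y) (φ n)) ∧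
    limsup (fun n : ℕ =>
      (∑' m : ℕ, μ {ω | ∀ i ≤ m, φ n (preL ω i) = none}) / (n : ℝ≥0∞)) atTop ≤ L

/-- `L⋆(X,Y)` : the infimum average achievable rate over all valid algorithms. -/
def Lstar [MeasurableSpace 𝒳] [MeasurableSpace 𝒴]
    (μ : Measure (ℕ → 𝒳)) (ν : Measure (ℕ → 𝒴)) : ℝ≥0∞ :=
  sInf {L : ℝ≥0∞ | AvgAchievable μ ν L}

/-- The spectral sup-entropy `H̄(X)`: the event `(1/m) log(1/P_{X^m}(X^m)) ≥ λ` is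
`P_{X^m}(X^m) ≤ 2^{-mλ}`. -/
def specSup [MeasurableSpace 𝒳] (μ : Measure (ℕ → 𝒳)) : ℝ :=
  sInf {lam : ℝ | Tendsto (fun m : ℕ =>
    (μ {ω | cylP μ (pre ω m) ≤ (2 : ℝ) ^ (-((m : ℝ) * lam))}).toReal) atTop (nhds 0)}

/-- The spectral inf-entropy `H̲(X)`: the event `(1/m) log(1/P_{X^m}(X^m)) ≤ λ` is
`P_{X^m}(X^m) ≥ 2^{-mλ}`. -/
def specInf [MeasurableSpace 𝒳] (μ : Measure (ℕ → 𝒳)) : ℝ :=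
  sSup {lam : ℝ | Tendsto (fun m : ℕ =>
    (μ {ω | (2 : ℝ) ^ (-((m : ℝ) * lam)) ≤ cylP μ (pre ω m)}).toReal) atTop (nhds 0)}

/-- The (sup-)entropy rate `H(X) = limsup (1/m) H(X^m)`. -/
def entRate [MeasurableSpace 𝒳] [Fintype 𝒳] (μ : Measure (ℕ → 𝒳)) : ℝ :=
  limsup (fun m : ℕ =>
    (∑ x : Fin m → 𝒳, cylP μ x * Real.logb 2 (1 / cylP μ x)) / (m : ℝ)) atTop

/-- Upper-tail condition: `Pr((1/m) log(1/P_{X^m}(X^m)) ≥ H̄(X)+δ) ≤ K/m²` eventually. -/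
def UpperTail [MeasurableSpace 𝒳] (μ : Measure (ℕ → 𝒳)) : Prop :=
  ∀ δ : ℝ, 0 < δ → ∃ (K : ℝ) (m₀ : ℕ), ∀ m : ℕ, m₀ ≤ m →
    (μ {ω | cylP μ (pre ω m) ≤ (2 : ℝ) ^ (-((m : ℝ) * (specSup μ + δ)))}).toReal
      ≤ K / (m : ℝ) ^ 2

/-- Lower-tail condition: `Pr((1/m) log(1/P_{X^m}(X^m)) ≤ H̲(X)−δ) ≤ K/m²` eventually. -/
def LowerTail [MeasurableSpace 𝒳] (μ : Measure (ℕ → 𝒳)) : Prop :=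
  ∀ δ : ℝ, 0 < δ → ∃ (K : ℝ) (m₀ : ℕ), ∀ m : ℕ, m₀ ≤ m →
    (μ {ω | (2 : ℝ) ^ (-((m : ℝ) * (specInf μ - δ))) ≤ cylP μ (pre ω m)}).toReal
      ≤ K / (m : ℝ) ^ 2

/-- The finite-dimensional distributions of a Markov chain with initial distribution `q`
and transition matrix `W` (`W x x'` is the transition probability from `x` to `x'`). -/
def markovP (q : 𝒳 → ℝ) (W : 𝒳 → 𝒳 → ℝ) : (m : ℕ) → (Fin m → 𝒳) → ℝ
  | 0, _ => 1
  | m + 1, x => q (x 0) * ∏ i : Fin m, W (x i.castSucc) (x i.succ)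

/-- `μ` is the law of the Markov chain with initial distribution `q` and transition matrix `W`. -/
def IsMarkovMeasure [MeasurableSpace 𝒳] (μ : Measure (ℕ → 𝒳)) (q : 𝒳 → ℝ)
    (W : 𝒳 → 𝒳 → ℝ) : Prop :=
  ∀ (m : ℕ) (x : Fin m → 𝒳), cylP μ x = markovP q W m x

/-- `W` is a (row-)stochastic transition matrix. -/
def IsTransMat [Fintype 𝒳] (W : 𝒳 → 𝒳 → ℝ) : Prop :=
  (∀ x x', 0 ≤ W x x') ∧ ∀ x, ∑ x', W x x' = 1

/-- Irreducibility: any state reaches any other in some `k ≥ 1` steps. -/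
def IrreducibleMat [Fintype 𝒳] [DecidableEq 𝒳] (W : Matrix 𝒳 𝒳 ℝ) : Prop :=
  ∀ x x' : 𝒳, ∃ k : ℕ, 1 ≤ k ∧ 0 < (W ^ k) x x'

/-- `π` is a stationary distribution of `W`. -/
def IsStationary [Fintype 𝒳] (π : 𝒳 → ℝ) (W : 𝒳 → 𝒳 → ℝ) : Prop :=
  (∀ x, 0 ≤ π x) ∧ (∑ x, π x = 1) ∧ ∀ x, ∑ x', π x' * W x' x = π x

/-- `q` is a probability distribution (initial distribution). -/
def IsInitial [Fintype 𝒳] (q : 𝒳 → ℝ) : Prop :=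
  (∀ x, 0 ≤ q x) ∧ ∑ x, q x = 1

/-- The entropy rate `H^W(X) = Σ_{x',x} π(x') W(x|x') log (1/W(x|x'))` of a stationary
Markov chain. -/
def matEnt [Fintype 𝒳] (π : 𝒳 → ℝ) (W : 𝒳 → 𝒳 → ℝ) : ℝ :=
  ∑ x' : 𝒳, ∑ x : 𝒳, π x' * W x' x * Real.logb 2 (1 / W x' x)

/-- The weight `w(ξ) = Pr(Y_1 ∈ 𝒴_ξ)` of the irreducible class `ξ` under the initial
distribution `q`, where `c` assigns to each state its class. -/
def wgt [Fintype 𝒴] {r : ℕ} (c : 𝒴 → Fin r) (q : 𝒴 → ℝ) (ξ : Fin r) : ℝ :=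
  ∑ y ∈ Finset.univ.filter (fun y => c y = ξ), q y

/-- The binary entropy function (base 2). -/
def binEnt (t : ℝ) : ℝ := t * Real.logb 2 (1 / t) + (1 - t) * Real.logb 2 (1 / (1 - t))

end RNG

open RNG

namespace RNG

/-- Sequences agreeing on their first `m` symbols have equal prefixes of length `i ≤ m`. -/
lemma preL_eq_of_agree {𝒳 : Type*} {ω ω' : ℕ → 𝒳} {m i : ℕ} (hi : i ≤ m)
    (h : ∀ k : Fin m, ω' k = pre ω m k) : preL ω' i = preL ω i :=
  List.map_congr_left fun k hk => h ⟨k, (List.mem_range.1 hk).trans_le hi⟩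

/-- If a valid algorithm stops within `m` symbols on `ω`, then it does so with an output whose
probability is at least that of the cylinder of the first `m` symbols of `ω`. -/
lemma Valid.exists_output_cylP_le {𝒳 B : Type*} [MeasurableSpace 𝒳] {μ : Measure (ℕ → 𝒳)}
    [IsProbabilityMeasure μ] {PY : B → ℝ} {φ : List 𝒳 → Option B} (hvalid : Valid μ PY φ)
    {m : ℕ} {ω : ℕ → 𝒳} (hω : ¬ ∀ i ≤ m, φ (preL ω i) = none) :
    ∃ y, (∃ i : ℕ, φ (preL ω i) = some y ∧ ∀ j < i, φ (preL ω j) = none) ∧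
      cylP μ (pre ω m) ≤ PY y := by
  push Not at hω
  obtain ⟨k, hkm, hk⟩ := hω
  have hex : ∃ i, φ (preL ω i) ≠ none := ⟨k, hk⟩
  obtain ⟨y, hy⟩ := Option.ne_none_iff_exists'.1 (Nat.find_spec hex)
  have hmin : ∀ j < Nat.find hex, φ (preL ω j) = none :=
    fun j hj => not_not.1 (Nat.find_min hex hj)
  have him : Nat.find hex ≤ m := (Nat.find_min' hex hk).trans hkm
  refine ⟨y, ⟨_, hy, hmin⟩, ?_⟩
  rw [← hvalid y]
  refine measureReal_mono (μ := μ) fun ω' hω' => ⟨Nat.find hex, ?_, fun j hj => ?_⟩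
  · rw [preL_eq_of_agree him hω', hy]
  · rw [preL_eq_of_agree (hj.le.trans him) hω', hmin j hj]

/-- If `lam ≤ τ`, the sequences with likely prefixes on which the algorithm stops produce
likely outputs. -/
lemma Valid.measure_likely_prefix_le {𝒳 B : Type*} [MeasurableSpace 𝒳] [Fintype B]
    {μ : Measure (ℕ → 𝒳)} [IsProbabilityMeasure μ] {PY : B → ℝ} {φ : List 𝒳 → Option B}
    (hvalid : Valid μ PY φ) (m : ℕ) {τ lam : ℝ} (h : lam ≤ τ) :
    (μ {ω | (2 : ℝ) ^ (-lam) < cylP μ (pre ω m)}).toReal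
      ≤ (μ {ω | ∀ i ≤ m, φ (preL ω i) = none}).toReal
        + ∑ y ∈ Finset.univ.filter (fun y : B => (2 : ℝ) ^ (-τ) ≤ PY y), PY y := by
  set F := Finset.univ.filter (fun y : B => (2 : ℝ) ^ (-τ) ≤ PY y)
  set D : B → Set (ℕ → 𝒳) :=
    fun y => {ω | ∃ i : ℕ, φ (preL ω i) = some y ∧ ∀ j < i, φ (preL ω j) = none}
  have hsub : {ω | (2 : ℝ) ^ (-lam) < cylP μ (pre ω m)}
      ⊆ {ω | ∀ i ≤ m, φ (preL ω i) = none} ∪ ⋃ y ∈ F, D y := by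
    intro ω hω
    by_cases hE : ∀ i ≤ m, φ (preL ω i) = none
    · exact Or.inl hE
    · obtain ⟨y, hyD, hle⟩ := hvalid.exists_output_cylP_le hE
      have hpow : (2 : ℝ) ^ (-τ) ≤ 2 ^ (-lam) :=
        Real.rpow_le_rpow_of_exponent_le one_le_two (neg_le_neg h)
      have hyF : y ∈ F := Finset.mem_filter.2
        ⟨Finset.mem_univ y, hpow.trans ((le_of_lt hω).trans hle)⟩
      exact Or.inr (Set.mem_biUnion hyF hyD)
  calc μ.real {ω | (2 : ℝ) ^ (-lam) < cylP μ (pre ω m)}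
      ≤ μ.real ({ω | ∀ i ≤ m, φ (preL ω i) = none} ∪ ⋃ y ∈ F, D y) := measureReal_mono hsub
    _ ≤ μ.real {ω | ∀ i ≤ m, φ (preL ω i) = none} + μ.real (⋃ y ∈ F, D y) :=
        measureReal_union_le _ _
    _ ≤ μ.real {ω | ∀ i ≤ m, φ (preL ω i) = none} + ∑ y ∈ F, μ.real (D y) := by
        gcongr
        exact measureReal_biUnion_finset_le F D
    _ = μ.real {ω | ∀ i ≤ m, φ (preL ω i) = none} + ∑ y ∈ F, PY y := by
        congr 1
        exact Finset.sum_congr rfl fun y _ => hvalid y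

end RNG

/-- **Theorem 1 (converse bound).** For any algorithm `φ` exactly generating `Y^n`
(with law `PY` on the finite set `B = 𝒴^n`) from the coin process `μ`, any `m ≥ 0` and any
`τ, λ ≥ 0`:
`Pr(T > m) ≥ P_{Y^n}(𝒯_n^c(τ)) − P_{X^m}(𝒮_m(λ)) − 2^{−τ+λ}` and
`Pr(T > m) ≥ P_{X^m}(𝒮_m^c(λ)) − P_{Y^n}(𝒯_n(τ)) − 2^{−τ+λ}`. -/
theorem converse_overflow_bound
    {𝒳 B : Type*} [Fintype 𝒳] [MeasurableSpace 𝒳] [DiscreteMeasurableSpace 𝒳] [Fintype B]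
    (μ : Measure (ℕ → 𝒳)) [IsProbabilityMeasure μ]
    (PY : B → ℝ) (hPY0 : ∀ y, 0 ≤ PY y) (hPY1 : ∑ y : B, PY y = 1)
    (φ : List 𝒳 → Option B) (hvalid : Valid μ PY φ)
    (m : ℕ) (τ lam : ℝ) (hτ : 0 ≤ τ) (hlam : 0 ≤ lam) :
    (∑ y ∈ Finset.univ.filter (fun y : B => PY y < (2 : ℝ) ^ (-τ)), PY y)
        - (μ {ω | cylP μ (pre ω m) ≤ (2 : ℝ) ^ (-lam)}).toReal
        - (2 : ℝ) ^ (-τ + lam)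
      ≤ (μ {ω | ∀ i ≤ m, φ (preL ω i) = none}).toReal
    ∧ (μ {ω | (2 : ℝ) ^ (-lam) < cylP μ (pre ω m)}).toReal
        - (∑ y ∈ Finset.univ.filter (fun y : B => (2 : ℝ) ^ (-τ) ≤ PY y), PY y)
        - (2 : ℝ) ^ (-τ + lam)
      ≤ (μ {ω | ∀ i ≤ m, φ (preL ω i) = none}).toReal := by
  have likely_le : (μ {ω | (2 : ℝ) ^ (-lam) < cylP μ (pre ω m)}).toReal
      - (∑ y ∈ Finset.univ.filter (fun y : B => (2 : ℝ) ^ (-τ) ≤ PY y), PY y)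
      - (2 : ℝ) ^ (-τ + lam)
      ≤ (μ {ω | ∀ i ≤ m, φ (preL ω i) = none}).toReal := by
    rcases le_total lam τ with h | h
    · have hpos : (0 : ℝ) < 2 ^ (-τ + lam) := by positivity
      linarith [hvalid.measure_likely_prefix_le m h]
    · have hpow : (1 : ℝ) ≤ 2 ^ (-τ + lam) := Real.one_le_rpow one_le_two (by linarith)
      have hsum := Finset.sum_nonneg fun y
        (_ : y ∈ Finset.univ.filter (fun y : B => (2 : ℝ) ^ (-τ) ≤ PY y)) => hPY0 y
      have hprob : (μ {ω | (2 : ℝ) ^ (-lam) < cylP μ (pre ω m)}).toReal ≤ 1 :=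
        measureReal_le_one
      have hnonneg : 0 ≤ (μ {ω | ∀ i ≤ m, φ (preL ω i) = none}).toReal := ENNReal.toReal_nonneg
      linarith
  refine ⟨?_, likely_le⟩
  have hsplit := Finset.sum_filter_add_sum_filter_not Finset.univ
    (fun y : B => PY y < (2 : ℝ) ^ (-τ)) PY
  simp only [not_lt] at hsplit
  have hcover : 1 ≤ (μ {ω | cylP μ (pre ω m) ≤ (2 : ℝ) ^ (-lam)}).toReal
      + (μ {ω | (2 : ℝ) ^ (-lam) < cylP μ (pre ω m)}).toReal := by
    have hunion := measureReal_union_le (μ := μ) {ω | cylP μ (pre ω m) ≤ (2 : ℝ) ^ (-lam)}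
      {ω | (2 : ℝ) ^ (-lam) < cylP μ (pre ω m)}
    have huniv : {ω | cylP μ (pre ω m) ≤ (2 : ℝ) ^ (-lam)}
        ∪ {ω | (2 : ℝ) ^ (-lam) < cylP μ (pre ω m)} = Set.univ :=
      Set.eq_univ_of_forall fun ω => le_or_gt (cylP μ (pre ω m)) _
    rwa [huniv, probReal_univ] at hunion
  linarith
end
end

section
/- For the interval algorithm generating Y^n from the coin process X, the overflow probability of the stopping time T satisfies Pr(T > m) ≤ P_{X^m}(S_m^c(λ)) + P_{Y^n}(T_n^c(τ)) + 2^{−λ+τ+1} for every integer m ≥ 0 and all real numbers λ, τ ≥ 0. -/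
open MeasureTheory Filter
open scoped ENNReal Classical

noncomputable section

namespace RNG

open Finset

/-- The total mass of the cells of a partition of the line that contain a given point in
their interior is at most the largest mass of a cell. -/
lemma sum_straddling_le {α : Type*} [Fintype α] (a P : α → ℝ) (δ t : ℝ) (hδ : 0 ≤ δ)
    (hd : ∀ x x', x ≠ x' → a x + P x ≤ a x' ∨ a x' + P x' ≤ a x) :
    ∑ x ∈ univ.filter (fun x => P x ≤ δ ∧ a x < t ∧ t < a x + P x), P x ≤ δ := by
  rcases (univ.filter (fun x => P x ≤ δ ∧ a x < t ∧ t < a x + P x)).eq_empty_or_nonempty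
    with h | ⟨z, hz⟩
  · simpa [h] using hδ
  · have : univ.filter (fun x => P x ≤ δ ∧ a x < t ∧ t < a x + P x) = {z} := by
      refine eq_singleton_iff_unique_mem.2 ⟨hz, fun w hw => ?_⟩
      simp only [mem_filter, mem_univ, true_and] at hz hw
      by_contra hne
      rcases hd w z hne with h | h <;> linarith
    rw [this, sum_singleton]
    exact (mem_filter.1 hz).2.1

/-- Half-open intervals, any two of which are ordered along the line, are pairwise disjoint. -/
lemma pairwise_disjoint_cells {α : Type*} (a P : α → ℝ)
    (hd : ∀ x x', x ≠ x' → a x + P x ≤ a x' ∨ a x' + P x' ≤ a x) :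
    Pairwise (Function.onFun Disjoint fun x => Set.Ico (a x) (a x + P x)) := by
  intro x x' hne
  refine Set.disjoint_left.2 fun t ht ht' => ?_
  rcases hd x x' hne with h | h <;> linarith [ht.1, ht.2, ht'.1, ht'.2]

/-- The length of a finite union of disjoint cells. -/
lemma volume_real_cells {α : Type*} (a P : α → ℝ) (hP : ∀ x, 0 ≤ P x)
    (hd : ∀ x x', x ≠ x' → a x + P x ≤ a x' ∨ a x' + P x' ≤ a x) (s : Finset α) :
    volume.real (⋃ x ∈ s, Set.Ico (a x) (a x + P x)) = ∑ x ∈ s, P x := by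
  rw [measureReal_biUnion_finset (fun x _ y _ h => pairwise_disjoint_cells a P hd h)
    (fun _ _ => measurableSet_Ico) (fun _ _ => measure_Ico_lt_top.ne)]
  refine sum_congr rfl fun x _ => ?_
  rw [Real.volume_real_Ico_of_le (by linarith [hP x])]
  ring

/-- Mass of the small cells `[a x, a x + P x)` contained in no cell `[b y, b y + Q y)`. -/
lemma sum_not_subset_le {α β : Type*} [Fintype α] [Fintype β] (a P : α → ℝ) (b Q : β → ℝ)
    (δ ε : ℝ) (hδ : 0 ≤ δ) (hε : 0 < ε) (hP : ∀ x, 0 ≤ P x) (hQ : ∀ y, 0 ≤ Q y)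
    (ha : ∀ x x', x ≠ x' → a x + P x ≤ a x' ∨ a x' + P x' ≤ a x)
    (hb : ∀ y y', y ≠ y' → b y + Q y ≤ b y' ∨ b y' + Q y' ≤ b y)
    (ha0 : ∀ x, 0 ≤ a x) (ha1 : ∀ x, a x + P x ≤ 1)
    (hb0 : ∀ y, 0 ≤ b y) (hb1 : ∀ y, b y + Q y ≤ 1) (hQ1 : ∑ y, Q y = 1) :
    ∑ x ∈ univ.filter (fun x => P x ≤ δ ∧
        ¬ ∃ y, Set.Ico (a x) (a x + P x) ⊆ Set.Ico (b y) (b y + Q y)), P x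
      ≤ (∑ y ∈ univ.filter (fun y => Q y < ε), Q y) + 2 * (δ / ε) := by
  set G := univ.filter (fun y => ¬ Q y < ε) with hG
  set D := univ.filter (fun x => ∀ y ∈ G,
    Disjoint (Set.Ico (a x) (a x + P x)) (Set.Ico (b y) (b y + Q y))) with hD
  set S : ℝ → Finset α := fun t =>
    univ.filter (fun x => P x ≤ δ ∧ a x < t ∧ t < a x + P x) with hS
  have hcover : univ.filter (fun x => P x ≤ δ ∧
        ¬ ∃ y, Set.Ico (a x) (a x + P x) ⊆ Set.Ico (b y) (b y + Q y))
      ⊆ D ∪ G.biUnion (fun y => S (b y) ∪ S (b y + Q y)) := by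
    intro x hx
    simp only [mem_filter, mem_univ, true_and, not_exists] at hx
    by_cases hxD : x ∈ D
    · exact mem_union_left _ hxD
    refine mem_union_right _ ?_
    simp only [hD, mem_filter, mem_univ, true_and, not_forall] at hxD
    obtain ⟨y, hy, hxy⟩ := hxD
    refine mem_biUnion.2 ⟨y, hy, ?_⟩
    obtain ⟨t, ht, ht'⟩ := Set.not_disjoint_iff.1 hxy
    obtain ⟨u, hu, hu'⟩ := Set.not_subset.1 (hx.2 y)
    simp only [hS, mem_union, mem_filter, mem_univ, true_and]
    simp only [Set.mem_Ico, not_and_or, not_le, not_lt] at ht ht' hu hu'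
    rcases hu' with h | h
    · exact Or.inl ⟨hx.1, by linarith, by linarith⟩
    · exact Or.inr ⟨hx.1, by linarith, by linarith⟩
  have hDle : ∑ x ∈ D, P x ≤ ∑ y ∈ univ.filter (fun y => Q y < ε), Q y := by
    have hsplit := sum_filter_add_sum_filter_not univ (fun y => Q y < ε) Q
    rw [← volume_real_cells a P hP ha D]
    have hGv := volume_real_cells b Q hQ hb G
    have hdisj : Disjoint (⋃ x ∈ D, Set.Ico (a x) (a x + P x))
        (⋃ y ∈ G, Set.Ico (b y) (b y + Q y)) := by
      simp only [Set.disjoint_iUnion_left, Set.disjoint_iUnion_right]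
      intro y hy x hx
      exact (mem_filter.1 hx).2 y hy
    have hsub : (⋃ x ∈ D, Set.Ico (a x) (a x + P x)) ∪ (⋃ y ∈ G, Set.Ico (b y) (b y + Q y))
        ⊆ Set.Ico (0 : ℝ) 1 := by
      refine Set.union_subset (Set.iUnion₂_subset fun x _ => ?_)
        (Set.iUnion₂_subset fun y _ => ?_)
      · exact Set.Ico_subset_Ico (ha0 x) (ha1 x)
      · exact Set.Ico_subset_Ico (hb0 y) (hb1 y)
    have hmono := measureReal_mono (μ := volume) hsub (by simp)
    have hfin : ∀ s : Set ℝ, s ⊆ Set.Ico (0 : ℝ) 1 → volume s ≠ ∞ := fun s hs =>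
      measure_ne_top_of_subset hs (by simp)
    rw [measureReal_union hdisj (G.measurableSet_biUnion fun _ _ => measurableSet_Ico)
      (hfin _ (Set.subset_union_left.trans hsub)) (hfin _ (Set.subset_union_right.trans hsub)),
      Real.volume_real_Ico_of_le zero_le_one] at hmono
    linarith
  have hGcard : (G.card : ℝ) ≤ 1 / ε := by
    rw [le_div_iff₀ hε, ← nsmul_eq_mul]
    calc G.card • ε ≤ ∑ y ∈ G, Q y :=
          card_nsmul_le_sum _ _ _ fun y hy => not_lt.1 (mem_filter.1 hy).2
      _ ≤ ∑ y, Q y := sum_le_sum_of_subset_of_nonneg (filter_subset _ _) fun y _ _ => hQ y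
      _ = 1 := hQ1
  have hunion : ∀ s t : Finset α, ∑ x ∈ s ∪ t, P x ≤ ∑ x ∈ s, P x + ∑ x ∈ t, P x := by
    intro s t
    rw [← sum_union_inter]
    exact le_add_of_nonneg_right (sum_nonneg fun x _ => hP x)
  have hS_le : ∀ t, ∑ x ∈ S t, P x ≤ δ := fun t => sum_straddling_le a P δ t hδ ha
  have hstr : ∑ x ∈ G.biUnion (fun y => S (b y) ∪ S (b y + Q y)), P x ≤ 2 * (δ / ε) := by
    calc ∑ x ∈ G.biUnion (fun y => S (b y) ∪ S (b y + Q y)), P x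
        ≤ ∑ y ∈ G, ∑ x ∈ S (b y) ∪ S (b y + Q y), P x := by
          induction G using Finset.induction_on with
          | empty => simp
          | insert y s hy ih =>
            rw [biUnion_insert, sum_insert hy]
            exact (hunion _ _).trans (by linarith)
      _ ≤ G.card • (2 * δ) := sum_le_card_nsmul _ _ _ fun y _ => by
          linarith [hunion (S (b y)) (S (b y + Q y)), hS_le (b y), hS_le (b y + Q y)]
      _ ≤ 1 / ε * (2 * δ) := by
          rw [nsmul_eq_mul]
          gcongr
      _ = 2 * (δ / ε) := by ring
  calc _ ≤ ∑ x ∈ D ∪ G.biUnion (fun y => S (b y) ∪ S (b y + Q y)), P x :=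
        sum_le_sum_of_subset_of_nonneg hcover fun x _ _ => hP x
    _ ≤ _ := (hunion _ _).trans (add_le_add hDle hstr)

variable {𝒳 : Type*}

lemma lexLt_trichotomy [LinearOrder 𝒳] {m : ℕ} (x y : Fin m → 𝒳) (h : x ≠ y) :
    lexLt x y ∨ lexLt y x :=
  lt_or_gt_of_ne (a := toLex x) (b := toLex y) h

lemma lexLt_trans [LinearOrder 𝒳] {m : ℕ} {x y z : Fin m → 𝒳} (h : lexLt x y)
    (h' : lexLt y z) : lexLt x z :=
  lt_trans (a := toLex x) (b := toLex y) (c := toLex z) h h'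

lemma lexLt_irrefl [LinearOrder 𝒳] {m : ℕ} (x : Fin m → 𝒳) : ¬ lexLt x x :=
  lt_irrefl (toLex x)

/-- The left endpoint of `itv P x`. -/
def lexCdf [LT 𝒳] [Fintype 𝒳] {m : ℕ} (P : (Fin m → 𝒳) → ℝ) (x : Fin m → 𝒳) : ℝ :=
  ∑ x' ∈ univ.filter (fun x' => lexLt x' x), P x'

lemma lexCdf_add [LinearOrder 𝒳] [Fintype 𝒳] {m : ℕ} (P : (Fin m → 𝒳) → ℝ)
    (x : Fin m → 𝒳) :
    lexCdf P x + P x = ∑ x' ∈ insert x (univ.filter (fun x' => lexLt x' x)), P x' := by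
  rw [sum_insert (by simpa using lexLt_irrefl x), lexCdf, add_comm]

lemma lexCdf_add_le_sum [LinearOrder 𝒳] [Fintype 𝒳] {m : ℕ} {P : (Fin m → 𝒳) → ℝ}
    (hP : ∀ x, 0 ≤ P x) (x : Fin m → 𝒳) : lexCdf P x + P x ≤ ∑ x', P x' := by
  rw [lexCdf_add]
  exact sum_le_sum_of_subset_of_nonneg (subset_univ _) fun x _ _ => hP x

lemma lexCdf_add_le [LinearOrder 𝒳] [Fintype 𝒳] {m : ℕ} {P : (Fin m → 𝒳) → ℝ}
    (hP : ∀ x, 0 ≤ P x) {x y : Fin m → 𝒳} (h : lexLt x y) :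
    lexCdf P x + P x ≤ lexCdf P y := by
  rw [lexCdf_add]
  refine sum_le_sum_of_subset_of_nonneg (fun z hz => ?_) fun x _ _ => hP x
  rcases mem_insert.1 hz with rfl | hz
  · simpa using h
  · simpa using lexLt_trans (mem_filter.1 hz).2 h

lemma lexCdf_separated [LinearOrder 𝒳] [Fintype 𝒳] {m : ℕ} {P : (Fin m → 𝒳) → ℝ}
    (hP : ∀ x, 0 ≤ P x) (x y : Fin m → 𝒳) (h : x ≠ y) :
    lexCdf P x + P x ≤ lexCdf P y ∨ lexCdf P y + P y ≤ lexCdf P x :=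
  (lexLt_trichotomy x y h).imp (lexCdf_add_le hP) (lexCdf_add_le hP)

lemma cylP_nonneg [MeasurableSpace 𝒳] (μ : Measure (ℕ → 𝒳)) {m : ℕ} (x : Fin m → 𝒳) :
    0 ≤ cylP μ x :=
  ENNReal.toReal_nonneg

lemma sum_cylP [MeasurableSpace 𝒳] [DiscreteMeasurableSpace 𝒳] (μ : Measure (ℕ → 𝒳))
    [IsFiniteMeasure μ] {m : ℕ} (s : Finset (Fin m → 𝒳)) :
    ∑ x ∈ s, cylP μ x = μ.real {ω | pre ω m ∈ s} := by
  have hcyl : ∀ x : Fin m → 𝒳, {ω : ℕ → 𝒳 | ∀ i : Fin m, ω i = x i}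
      = (fun ω => pre ω m) ⁻¹' {x} := fun x => by
    ext ω
    exact funext_iff.symm
  have hmeas : ∀ x : Fin m → 𝒳, MeasurableSet ((fun ω : ℕ → 𝒳 => pre ω m) ⁻¹' {x}) := by
    intro x
    have hpre : Measurable fun ω : ℕ → 𝒳 => pre ω m :=
      measurable_pi_lambda _ fun i => measurable_pi_apply (i : ℕ)
    exact hpre (measurableSet_singleton x)
  calc ∑ x ∈ s, cylP μ x = ∑ x ∈ s, μ.real ((fun ω => pre ω m) ⁻¹' {x}) :=
        sum_congr rfl fun x _ => by rw [← hcyl]; rfl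
    _ = μ.real ((fun ω => pre ω m) ⁻¹' s) :=
        sum_measureReal_preimage_singleton s fun x _ => hmeas x
    _ = _ := rfl

lemma sum_cylP_univ [Fintype 𝒳] [MeasurableSpace 𝒳] [DiscreteMeasurableSpace 𝒳]
    (μ : Measure (ℕ → 𝒳)) [IsProbabilityMeasure μ] (m : ℕ) :
    ∑ x : Fin m → 𝒳, cylP μ x = 1 := by
  simp [sum_cylP]

end RNG

open RNG
/-- **Theorem 2 (achievability of the interval algorithm).** For the interval algorithm
generating `Y^n` (target law `ν`) from the coin process `μ`, the overflow probability of
the stopping time satisfies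
`Pr(T > m) ≤ P_{X^m}(𝒮_m^c(λ)) + P_{Y^n}(𝒯_n^c(τ)) + 2^{−λ+τ+1}`
for every `m ≥ 0` and all `λ, τ ≥ 0`. -/
theorem interval_overflow_bound
    {𝒳 𝒴 : Type*} [Fintype 𝒳] [LinearOrder 𝒳] [MeasurableSpace 𝒳] [DiscreteMeasurableSpace 𝒳]
    [Fintype 𝒴] [LinearOrder 𝒴] [MeasurableSpace 𝒴] [DiscreteMeasurableSpace 𝒴]
    (μ : Measure (ℕ → 𝒳)) [IsProbabilityMeasure μ]
    (ν : Measure (ℕ → 𝒴)) [IsProbabilityMeasure ν]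
    (n m : ℕ) (lam τ : ℝ) (hlam : 0 ≤ lam) (hτ : 0 ≤ τ) :
    (μ {ω | ¬ IntStopped μ ν n m ω}).toReal
      ≤ (μ {ω | (2 : ℝ) ^ (-lam) < cylP μ (pre ω m)}).toReal
        + (∑ y ∈ Finset.univ.filter (fun y : Fin n → 𝒴 => cylP ν y < (2 : ℝ) ^ (-τ)), cylP ν y)
        + (2 : ℝ) ^ (-lam + τ + 1) := by
  have hμ := cylP_nonneg (m := m) μ
  have hν := cylP_nonneg (m := n) ν
  have key := sum_not_subset_le (lexCdf fun x : Fin m → 𝒳 => cylP μ x) (fun x => cylP μ x)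
    (lexCdf fun y : Fin n → 𝒴 => cylP ν y) (fun y => cylP ν y)
    ((2 : ℝ) ^ (-lam)) ((2 : ℝ) ^ (-τ)) (by positivity) (by positivity) hμ hν
    (lexCdf_separated hμ) (lexCdf_separated hν)
    (fun _ => Finset.sum_nonneg fun x _ => hμ x)
    (fun x => (lexCdf_add_le_sum hμ x).trans_eq (sum_cylP_univ μ m))
    (fun _ => Finset.sum_nonneg fun y _ => hν y)
    (fun y => (lexCdf_add_le_sum hν y).trans_eq (sum_cylP_univ ν n)) (sum_cylP_univ ν n)
  rw [sum_cylP] at key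
  have hpow : 2 * ((2 : ℝ) ^ (-lam) / (2 : ℝ) ^ (-τ)) = (2 : ℝ) ^ (-lam + τ + 1) := by
    rw [← Real.rpow_sub two_pos, Real.rpow_add_one two_ne_zero, mul_comm, sub_neg_eq_add]
  rw [hpow] at key
  refine (measureReal_mono (fun ω hω => ?_)).trans
    ((measureReal_union_le (μ := μ) {ω | (2 : ℝ) ^ (-lam) < cylP μ (pre ω m)} _).trans
      ((add_le_add_right key _).trans_eq (add_assoc _ _ _).symm))
  by_cases h : (2 : ℝ) ^ (-lam) < cylP μ (pre ω m)
  · exact Or.inl h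
  · exact Or.inr (Finset.mem_filter.2 ⟨Finset.mem_univ _, not_lt.1 h, hω⟩)
end
end

section
/- If the coin process X = {X^m} satisfies lim_{m→∞} P_{X^m}(S_m^c(λ)) = 0 for every λ > 0, then the interval algorithm is valid: lim_{m→∞} Pr(φ_int(X^m) = y^n) = P_{Y^n}(y^n) for every y^n ∈ 𝒴^n and every target distribution P_{Y^n}. -/
open MeasureTheory Filter
open scoped ENNReal Classical

noncomputable section

open RNG
namespace RNG

section Lex

variable {α : Type*} [LinearOrder α] [Fintype α] {m : ℕ}

instance isStrictTotalOrder_lexLt : IsStrictTotalOrder (Fin m → α) lexLt :=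
  inferInstanceAs (IsStrictTotalOrder (Lex (Fin m → α)) (· < ·))

/-- The left endpoint of `itv P x`. -/
def leftEnd (P : (Fin m → α) → ℝ) (x : Fin m → α) : ℝ :=
  ∑ x' ∈ Finset.univ.filter (fun x' => lexLt x' x), P x'

lemma itv_eq_Ico (P : (Fin m → α) → ℝ) (x : Fin m → α) :
    itv P x = Set.Ico (leftEnd P x) (leftEnd P x + P x) := rfl

lemma leftEnd_add (P : (Fin m → α) → ℝ) (x : Fin m → α) :
    leftEnd P x + P x = ∑ x' ∈ Finset.univ.filter (fun x' => ¬ lexLt x x'), P x' := by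
  have h : Finset.univ.filter (fun x' : Fin m → α => ¬ lexLt x x')
      = insert x (Finset.univ.filter (fun x' => lexLt x' x)) := by
    ext z
    simp only [Finset.mem_filter, Finset.mem_univ, true_and, Finset.mem_insert]
    constructor
    · intro hz
      rcases trichotomous_of lexLt x z with h | h | h
      exacts [absurd h hz, Or.inl h.symm, Or.inr h]
    · rintro (rfl | h)
      exacts [irrefl_of lexLt z, asymm_of lexLt h]
  rw [h, Finset.sum_insert (by simpa using irrefl_of lexLt x), add_comm, leftEnd]

variable {P : (Fin m → α) → ℝ} (hP : ∀ x, 0 ≤ P x)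

include hP in
lemma leftEnd_nonneg (x : Fin m → α) : 0 ≤ leftEnd P x := Finset.sum_nonneg fun z _ => hP z

include hP in
lemma leftEnd_add_le_sum (x : Fin m → α) : leftEnd P x + P x ≤ ∑ z, P z := by
  rw [leftEnd_add]
  exact Finset.sum_le_sum_of_subset_of_nonneg (Finset.filter_subset _ _) fun z _ _ => hP z

include hP in
lemma leftEnd_add_le_leftEnd {x z : Fin m → α} (h : lexLt x z) :
    leftEnd P x + P x ≤ leftEnd P z := by
  rw [leftEnd_add]
  refine Finset.sum_le_sum_of_subset_of_nonneg ?_ fun w _ _ => hP w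
  intro w hw
  simp only [Finset.mem_filter, Finset.mem_univ, true_and] at hw ⊢
  rcases trichotomous_of lexLt x w with h' | rfl | h'
  exacts [absurd h' hw, h, trans_of lexLt h' h]

include hP in
lemma disjoint_itv {x z : Fin m → α} (h : x ≠ z) : Disjoint (itv P x) (itv P z) := by
  have key : ∀ {x z : Fin m → α}, lexLt x z → Disjoint (itv P x) (itv P z) := by
    intro x z h
    rw [Set.disjoint_left]
    intro t ht ht'
    rw [itv_eq_Ico] at ht ht'
    linarith [ht.2, ht'.1, leftEnd_add_le_leftEnd hP h]
  rcases trichotomous_of lexLt x z with h' | h' | h'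
  exacts [key h', absurd h' h, (key h').symm]

/-- The intervals of all strings cover `[0, ∑ P)`. -/
lemma exists_mem_itv {t : ℝ} (ht0 : 0 ≤ t) (ht1 : t < ∑ x, P x) :
    ∃ x, t ∈ itv P x := by
  have hne : (Set.univ : Set (Fin m → α)).Nonempty := by
    by_contra h
    rw [Set.not_nonempty_iff_eq_empty, Set.univ_eq_empty_iff] at h
    rw [Fintype.sum_empty] at ht1
    linarith
  obtain ⟨x₀, -, hx₀⟩ := (Finite.wellFounded_of_trans_of_irrefl lexLt).has_min _ hne
  have hmin : leftEnd P x₀ = 0 :=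
    Finset.sum_eq_zero fun z hz => absurd (Finset.mem_filter.1 hz).2 (hx₀ z (Set.mem_univ z))
  obtain ⟨x, hx, hmax⟩ := (Finite.wellFounded_of_trans_of_irrefl
    (Function.swap (lexLt (𝒳 := α) (m := m)))).has_min {x | leftEnd P x ≤ t}
    ⟨x₀, hmin.trans_le ht0⟩
  refine ⟨x, hx, ?_⟩
  by_contra hlt
  replace hlt : leftEnd P x + P x ≤ t := not_lt.1 hlt
  rw [leftEnd_add] at hlt
  by_cases hS : {z | lexLt x z}.Nonempty
  · obtain ⟨z, hz, hzmin⟩ := (Finite.wellFounded_of_trans_of_irrefl lexLt).has_min _ hS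
    refine hmax z (le_of_eq_of_le ?_ hlt) hz
    refine Finset.sum_congr (Finset.filter_congr fun w _ => ?_) fun _ _ => rfl
    refine ⟨fun h h' => hzmin w h' h, fun h => ?_⟩
    rcases trichotomous_of lexLt x w with h' | rfl | h'
    exacts [absurd h' h, hz, trans_of lexLt h' hz]
  · have hall : ∀ w ∈ Finset.univ, ¬ lexLt x w := fun w _ hw => hS ⟨w, hw⟩
    rw [Finset.filter_true_of_mem hall] at hlt
    linarith

include hP in
lemma volume_real_itv (x : Fin m → α) : volume.real (itv P x) = P x := by
  rw [itv_eq_Ico, Real.volume_real_Ico_of_le (by linarith [hP x])]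
  ring

include hP in
lemma sum_itv_subset_le {a b : ℝ} (hab : a ≤ b) :
    ∑ x with itv P x ⊆ Set.Ico a b, P x ≤ b - a := by
  calc ∑ x with itv P x ⊆ Set.Ico a b, P x
      = volume.real (⋃ x ∈ Finset.univ.filter fun x => itv P x ⊆ Set.Ico a b, itv P x) := by
        rw [measureReal_biUnion_finset (fun x _ z _ h => disjoint_itv hP h)
          (fun x _ => measurableSet_Ico) (fun x _ => by rw [itv_eq_Ico]; simp)]
        exact Finset.sum_congr rfl fun x _ => (volume_real_itv hP x).symm
    _ ≤ volume.real (Set.Ico a b) := by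
        refine measureReal_mono (Set.iUnion₂_subset fun x hx => (Finset.mem_filter.1 hx).2) ?_
        simp
    _ = b - a := Real.volume_real_Ico_of_le hab

include hP in
lemma le_sum_itv_subset {a b ε : ℝ} (ha : 0 ≤ a) (hab : a ≤ b) (hb : b ≤ ∑ x, P x)
    (hε : 0 ≤ ε) :
    b - a ≤ ∑ x with itv P x ⊆ Set.Ico a b, P x + ∑ x with ε < P x, P x + 2 * ε := by
  set A := ⋃ x ∈ Finset.univ.filter fun x => itv P x ⊆ Set.Ico a b, itv P x with hA
  set B := ⋃ x ∈ Finset.univ.filter fun x => ε < P x, itv P x with hB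
  have hbU (s : Finset (Fin m → α)) : volume.real (⋃ x ∈ s, itv P x) ≤ ∑ x ∈ s, P x :=
    (measureReal_biUnion_finset_le _ _).trans_eq
      (Finset.sum_congr rfl fun x _ => volume_real_itv hP x)
  have hfin (s : Finset (Fin m → α)) : volume (⋃ x ∈ s, itv P x) ≠ ⊤ :=
    (measure_biUnion_lt_top s.finite_toSet fun x _ => by rw [itv_eq_Ico]; simp).ne
  have hcover : Set.Ico a b ⊆ (A ∪ B) ∪ (Set.Ico a (a + ε) ∪ Set.Ico (b - ε) b) := by
    intro t ht
    obtain ⟨x, hx⟩ := exists_mem_itv (P := P) (ha.trans ht.1) (ht.2.trans_le hb)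
    by_cases hxJ : itv P x ⊆ Set.Ico a b
    · exact Or.inl (Or.inl (Set.mem_biUnion (by simpa using hxJ) hx))
    by_cases hxε : ε < P x
    · exact Or.inl (Or.inr (Set.mem_biUnion (by simpa using hxε) hx))
    right
    rw [itv_eq_Ico] at hx hxJ
    by_cases hl : a ≤ leftEnd P x
    · have hr : b < leftEnd P x + P x :=
        not_le.1 fun h => hxJ (Set.Ico_subset_Ico hl h)
      exact Or.inr ⟨by linarith [hx.1], ht.2⟩
    · exact Or.inl ⟨ht.1, by linarith [hx.2]⟩
  calc b - a = volume.real (Set.Ico a b) := (Real.volume_real_Ico_of_le hab).symm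
    _ ≤ volume.real ((A ∪ B) ∪ (Set.Ico a (a + ε) ∪ Set.Ico (b - ε) b)) :=
        measureReal_mono hcover (measure_union_ne_top (measure_union_ne_top (hfin _) (hfin _))
          (measure_union_ne_top (by simp) (by simp)))
    _ ≤ (volume.real A + volume.real B)
        + (volume.real (Set.Ico a (a + ε)) + volume.real (Set.Ico (b - ε) b)) :=
        (measureReal_union_le _ _).trans
          (add_le_add (measureReal_union_le _ _) (measureReal_union_le _ _))
    _ ≤ (∑ x with itv P x ⊆ Set.Ico a b, P x + ∑ x with ε < P x, P x) + (ε + ε) := by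
        rw [Real.volume_real_Ico_of_le (by linarith), Real.volume_real_Ico_of_le (by linarith)]
        exact add_le_add (add_le_add (hbU _) (hbU _)) (by linarith)
    _ = _ := by ring

end Lex

section Prefix

variable {α : Type*} [Fintype α] [MeasurableSpace α] [DiscreteMeasurableSpace α]
  (μ : Measure (ℕ → α)) [IsProbabilityMeasure μ]

lemma toReal_measure_pre (m : ℕ) (Q : (Fin m → α) → Prop) :
    (μ {ω | Q (pre ω m)}).toReal = ∑ x with Q x, cylP μ x := by
  have hU : {ω : ℕ → α | Q (pre ω m)}
      = ⋃ x ∈ Finset.univ.filter Q, {ω : ℕ → α | ∀ i : Fin m, ω i = x i} := by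
    ext ω
    simp only [Set.mem_ofPred_eq, Set.mem_iUnion, Finset.mem_filter, Finset.mem_univ, true_and,
      exists_prop]
    constructor
    · exact fun h => ⟨pre ω m, h, fun _ => rfl⟩
    · rintro ⟨x, hx, h⟩
      rwa [show pre ω m = x from funext h]
  rw [hU]
  refine measureReal_biUnion_finset ?_ ?_
  · intro x _ z _ hxz
    refine Set.disjoint_left.2 fun ω hx hz => hxz (funext fun i => ?_)
    exact (hx i).symm.trans (hz i)
  · intro x _
    rw [Set.ofPred_forall]
    exact MeasurableSet.iInter fun i =>
      (MeasurableSet.of_discrete (s := {x i})).preimage (measurable_pi_apply (i : ℕ))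

lemma sum_cylP_s2 (m : ℕ) : ∑ x : Fin m → α, cylP μ x = 1 := by
  simpa using (toReal_measure_pre μ m fun _ => True).symm

end Prefix

end RNG

/-- **Corollary 1 (validity of the interval algorithm).** If the coin process `μ` has
diverging randomness, i.e. `P_{X^m}(𝒮_m^c(λ)) → 0` for every `λ > 0`, then the interval
algorithm is valid: for every `n`, every target distribution `PY` on `𝒴^n`, and every
`y^n`, `Pr(φ_int(X^m) = y^n) → P_{Y^n}(y^n)` as `m → ∞`.  (The interval algorithm outputs
`y` within `m` coin symbols iff the coin interval `I_{x^m}` is contained in `J_{y}`.) -/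
theorem interval_algorithm_valid
    {𝒳 : Type*} [Fintype 𝒳] [LinearOrder 𝒳] [MeasurableSpace 𝒳] [DiscreteMeasurableSpace 𝒳]
    (μ : Measure (ℕ → 𝒳)) [IsProbabilityMeasure μ]
    (hdiv : ∀ lam : ℝ, 0 < lam →
      Tendsto (fun m : ℕ => (μ {ω | (2 : ℝ) ^ (-lam) < cylP μ (pre ω m)}).toReal)
        atTop (nhds 0))
    {𝒴 : Type*} [Fintype 𝒴] [LinearOrder 𝒴] (n : ℕ)
    (PY : (Fin n → 𝒴) → ℝ) (hPY0 : ∀ y, 0 ≤ PY y) (hPY1 : ∑ y, PY y = 1)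
    (y : Fin n → 𝒴) :
    Tendsto (fun m : ℕ =>
        (μ {ω | itv (fun x : Fin m → 𝒳 => cylP μ x) (pre ω m) ⊆ itv PY y}).toReal)
      atTop (nhds (PY y)) := by
  have hP (m : ℕ) (x : Fin m → 𝒳) : 0 ≤ cylP μ x := ENNReal.toReal_nonneg
  have ha : 0 ≤ leftEnd PY y := leftEnd_nonneg hPY0 y
  have hb : leftEnd PY y + PY y ≤ 1 := (leftEnd_add_le_sum hPY0 y).trans_eq hPY1
  have hab : leftEnd PY y ≤ leftEnd PY y + PY y := by linarith [hPY0 y]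
  have hprob (m : ℕ) :
      (μ {ω | itv (fun x : Fin m → 𝒳 => cylP μ x) (pre ω m) ⊆ itv PY y}).toReal
        = ∑ x : Fin m → 𝒳 with
          itv (cylP μ) x ⊆ Set.Ico (leftEnd PY y) (leftEnd PY y + PY y), cylP μ x :=
    toReal_measure_pre μ m fun x => itv (cylP μ) x ⊆ itv PY y
  simp only [hprob]
  rw [Metric.tendsto_atTop]
  intro δ hδ
  obtain ⟨k, hk⟩ := exists_pow_lt_of_lt_one (show 0 < δ / 4 by linarith)
    (show (1 / 2 : ℝ) < 1 by norm_num)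
  have hε : (2 : ℝ) ^ (-((k : ℝ) + 1)) < δ / 4 := by
    refine lt_of_le_of_lt ?_ hk
    rw [one_div, inv_pow, ← Real.rpow_natCast, ← Real.rpow_neg (by norm_num)]
    exact Real.rpow_le_rpow_of_exponent_le (by norm_num) (by linarith)
  obtain ⟨N, hN⟩ := Metric.tendsto_atTop.1 (hdiv (k + 1) (by positivity)) (δ / 2) (by linarith)
  refine ⟨N, fun m hm => ?_⟩
  have hsmall := hN m hm
  rw [toReal_measure_pre μ m fun x => (2 : ℝ) ^ (-((k : ℝ) + 1)) < cylP μ x,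
    Real.dist_eq, sub_zero] at hsmall
  have hupper := sum_itv_subset_le (hP m) hab
  have hlower := le_sum_itv_subset (hP m) ha hab (hb.trans_eq (sum_cylP_s2 μ m).symm)
    (ε := (2 : ℝ) ^ (-((k : ℝ) + 1))) (by positivity)
  rw [Real.dist_eq, abs_lt]
  constructor <;> linarith [le_abs_self (∑ x : Fin m → 𝒳 with
    (2 : ℝ) ^ (-((k : ℝ) + 1)) < cylP μ x, cylP μ x)]
end
end
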